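/- arXiv:1503.02164 — 2 statements merged into one kernel-verified Lean document; each statement's English description precedes it below -/
import Mathlib

section
/- Let 0 < q ≤ 1, let D ∈ ℝ^{n×d} be surjective (full row rank), let X ∈ ℝ^{m×d} with 4k < n, and let c₂ > 0 be a constant such that for every β ∈ ℝ^d, every minimizer β̂ of the noiseless ℓq-analysis minimization problem with data y = Xβ satisfies ‖Dβ̂ − Dβ‖_q^q ≤ 2(2c₂^q + 1)·σ_k(Dβ)_q^q. Then the number of measurements must satisfy m ≥ C₂·q·k·log(n/(4k)), where C₂ = 1/(2·log(8c₂^q + 7)). -/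
open scoped BigOperators

noncomputable section

/-- ℓq quasi-norm to the q-th power: `‖v‖_q^q = ∑ i |v i|^q`. -/
def lqq {n : ℕ} (q : ℝ) (v : Fin n → ℝ) : ℝ := ∑ i, |v i| ^ q

/-- number of nonzero entries of a vector (the ℓ0 "norm"). -/
def l0 {n : ℕ} (v : Fin n → ℝ) : ℕ := (Finset.univ.filter (fun i => v i ≠ 0)).card

/-- Best `k`-term approximation error of `u` in the ℓq quasi-norm. -/
def sigmaK {n : ℕ} (k : ℕ) (q : ℝ) (u : Fin n → ℝ) : ℝ :=
  sInf {r : ℝ | ∃ z : Fin n → ℝ, l0 z ≤ k ∧ r = (lqq q (u - z)) ^ (1 / q)}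

/-- `β̂` is a minimizer of the noiseless ℓq-analysis minimization problem with data `y`. -/
def Minimizer {m n d : ℕ} (q : ℝ) (X : Matrix (Fin m) (Fin d) ℝ)
    (D : Matrix (Fin n) (Fin d) ℝ) (y : Fin m → ℝ) (β : Fin d → ℝ) : Prop :=
  X.mulVec β = y ∧
    ∀ z : Fin d → ℝ, X.mulVec z = y → lqq q (D.mulVec β) ≤ lqq q (D.mulVec z)

section lqq

variable {n : ℕ} {q : ℝ}

lemma lqq_nonneg (q : ℝ) (v : Fin n → ℝ) : 0 ≤ lqq q v :=
  Finset.sum_nonneg fun _ _ => Real.rpow_nonneg (abs_nonneg _) _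

lemma lqq_zero (hq : q ≠ 0) : lqq q (0 : Fin n → ℝ) = 0 := by
  simp [lqq, Real.zero_rpow hq]

lemma lqq_neg (q : ℝ) (v : Fin n → ℝ) : lqq q (-v) = lqq q v := by
  simp [lqq]

lemma lqq_sub_comm (q : ℝ) (v w : Fin n → ℝ) : lqq q (v - w) = lqq q (w - v) := by
  rw [← lqq_neg, neg_sub]

lemma lqq_add_le (hq0 : 0 ≤ q) (hq1 : q ≤ 1) (v w : Fin n → ℝ) :
    lqq q (v + w) ≤ lqq q v + lqq q w := by
  rw [lqq, lqq, lqq, ← Finset.sum_add_distrib]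
  refine Finset.sum_le_sum fun i _ => ?_
  exact (Real.rpow_le_rpow (abs_nonneg _) (abs_add_le _ _) hq0).trans
    (Real.rpow_add_le_add_rpow (abs_nonneg _) (abs_nonneg _) hq0 hq1)

lemma lqq_smul {a : ℝ} (ha : 0 ≤ a) (v : Fin n → ℝ) : lqq q (a • v) = a ^ q * lqq q v := by
  simp only [lqq, Finset.mul_sum, Pi.smul_apply, smul_eq_mul, abs_mul, abs_of_nonneg ha]
  exact Finset.sum_congr rfl fun i _ => Real.mul_rpow ha (abs_nonneg _)

lemma continuous_lqq (hq0 : 0 ≤ q) : Continuous (lqq q : (Fin n → ℝ) → ℝ) := by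
  unfold lqq
  exact continuous_finsetSum _ fun i _ =>
    (continuous_apply i).abs.rpow_const fun _ => Or.inr hq0

lemma isCompact_lqq_le (hq0 : 0 < q) (c : ℝ) :
    IsCompact {v : Fin n → ℝ | lqq q v ≤ c} := by
  refine Metric.isCompact_of_isClosed_isBounded
    (isClosed_le (continuous_lqq hq0.le) continuous_const) ?_
  refine (Metric.isBounded_iff_subset_closedBall 0).2 ⟨c ^ q⁻¹, fun v hv => ?_⟩
  have hc : 0 ≤ c := (lqq_nonneg q v).trans hv
  rw [mem_closedBall_zero_iff, pi_norm_le_iff_of_nonneg (Real.rpow_nonneg hc _)]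
  intro i
  rw [Real.norm_eq_abs, Real.le_rpow_inv_iff_of_pos (abs_nonneg _) hc hq0]
  exact (Finset.single_le_sum (f := fun i => |v i| ^ q)
    (fun j _ => Real.rpow_nonneg (abs_nonneg _) _) (Finset.mem_univ i)).trans hv

lemma exists_lqq_minimizer (hq0 : 0 < q) (V : Submodule ℝ (Fin n → ℝ)) (u : Fin n → ℝ) :
    ∃ w, w - u ∈ V ∧ ∀ z, z - u ∈ V → lqq q w ≤ lqq q z := by
  have hcl : IsClosed {w | w - u ∈ V} :=
    (Submodule.closed_of_finiteDimensional V).preimage (continuous_id.sub continuous_const)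
  obtain ⟨w, ⟨hw, hwV⟩, hmin⟩ := ((isCompact_lqq_le hq0 (lqq q u)).inter_right hcl).exists_isMinOn
    ⟨u, by simp⟩ (continuous_lqq hq0.le).continuousOn
  refine ⟨w, hwV, fun z hz => ?_⟩
  by_cases h : lqq q z ≤ lqq q u
  · exact hmin ⟨h, hz⟩
  · exact le_trans hw (not_le.1 h).le

lemma sigmaK_rpow_le (hq0 : 0 < q) {k : ℕ} {z : Fin n → ℝ} (hz : l0 z ≤ k) (u : Fin n → ℝ) :
    sigmaK k q u ^ q ≤ lqq q (u - z) := by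
  have hnn : ∀ r ∈ {r : ℝ | ∃ z : Fin n → ℝ, l0 z ≤ k ∧ r = (lqq q (u - z)) ^ (1 / q)}, 0 ≤ r := by
    rintro _ ⟨z, -, rfl⟩
    exact Real.rpow_nonneg (lqq_nonneg _ _) _
  calc sigmaK k q u ^ q ≤ (lqq q (u - z) ^ (1 / q)) ^ q :=
        Real.rpow_le_rpow (Real.sInf_nonneg hnn) (csInf_le ⟨0, hnn⟩ ⟨z, hz, rfl⟩) hq0.le
    _ = lqq q (u - z) := by
        rw [one_div, Real.rpow_inv_rpow (lqq_nonneg _ _) hq0.ne']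

end lqq

section coding

variable {k b : ℕ}

/-- The number of coordinates on which two words agree. -/
def agreement (f g : Fin k → Fin b) : ℕ := (Finset.univ.filter fun j => f j = g j).card

lemma agreement_comm (f g : Fin k → Fin b) : agreement f g = agreement g f := by
  simp only [agreement, eq_comm]

lemma sum_pow_agreement (t : ℝ) (g : Fin k → Fin b) :
    ∑ f : Fin k → Fin b, t ^ agreement f g = (t + (b - 1)) ^ k := by
  have h : ∀ f : Fin k → Fin b, t ^ agreement f g = ∏ j, if f j = g j then t else 1 := by
    intro f
    rw [Finset.prod_ite, Finset.prod_const_one, mul_one, Finset.prod_const, agreement]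
  have h2 : ∀ j, ∑ x : Fin b, (if x = g j then t else 1) = t + (b - 1) := by
    intro j
    have hx : ∀ x : Fin b, (if x = g j then t else 1) = (if x = g j then t - 1 else 0) + 1 := by
      intro x; split_ifs <;> ring
    simp only [hx, Finset.sum_add_distrib, Finset.sum_ite_eq', Finset.mem_univ, if_true,
      Finset.sum_const, Finset.card_univ, Fintype.card_fin, nsmul_eq_mul]
    ring
  simp only [h]
  have := Finset.prod_univ_sum (fun _ : Fin k => (Finset.univ : Finset (Fin b)))
    (fun j x => if x = g j then t else 1)
  rw [Fintype.piFinset_univ] at this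
  rw [← this]
  simp [h2]

lemma card_agreement_ball_le (hb : 2 ≤ b) (g : Fin k → Fin b) :
    ((Finset.univ.filter fun f => k ≤ 2 * agreement f g).card : ℝ)
      ≤ (2 * √((b : ℝ) - 1)) ^ k := by
  have hb' : (2 : ℝ) ≤ b := by exact_mod_cast hb
  set s := √((b : ℝ) - 1) with hs
  have hs1 : 1 ≤ s := Real.one_le_sqrt.2 (by linarith)
  have hsq : s ^ 2 = b - 1 := Real.sq_sqrt (by linarith)
  have hsk : 0 < s ^ k := by positivity
  have hmul : ((Finset.univ.filter fun f => k ≤ 2 * agreement f g).card : ℝ) * s ^ k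
      ≤ (2 * s) ^ k * s ^ k := by
    calc _ = ∑ f ∈ Finset.univ.filter fun f => k ≤ 2 * agreement f g, s ^ k := by
          rw [Finset.sum_const, nsmul_eq_mul]
      _ ≤ ∑ f ∈ Finset.univ.filter fun f => k ≤ 2 * agreement f g, (s ^ 2) ^ agreement f g := by
          refine Finset.sum_le_sum fun f hf => ?_
          rw [← pow_mul]
          exact pow_le_pow_right₀ hs1 (Finset.mem_filter.1 hf).2
      _ ≤ ∑ f, (s ^ 2) ^ agreement f g :=
          Finset.sum_le_sum_of_subset_of_nonneg (Finset.filter_subset _ _)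
            fun _ _ _ => by positivity
      _ = (2 * s) ^ k * s ^ k := by
          rw [sum_pow_agreement, ← hsq, ← mul_pow]
          congr 1
          ring
  exact le_of_mul_le_mul_right hmul hsk

/-- A Gilbert–Varshamov bound. -/
lemma exists_code (hb : 2 ≤ b) : ∃ C : Finset (Fin k → Fin b),
    (∀ f ∈ C, ∀ g ∈ C, f ≠ g → 2 * agreement f g < k) ∧
      (b : ℝ) ^ k ≤ C.card * (2 * √((b : ℝ) - 1)) ^ k := by
  obtain ⟨C, -, hC⟩ := Finite.exists_le_maximal
    (p := fun C : Finset (Fin k → Fin b) => ∀ f ∈ C, ∀ g ∈ C, f ≠ g → 2 * agreement f g < k)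
    (a := ∅) (by simp)
  refine ⟨C, hC.prop, ?_⟩
  have hcover : (Finset.univ : Finset (Fin k → Fin b)) ⊆
      C.biUnion fun g => Finset.univ.filter fun f => k ≤ 2 * agreement f g := by
    intro f _
    simp only [Finset.mem_biUnion, Finset.mem_filter, Finset.mem_univ, true_and]
    by_contra! hf
    have hmem : f ∈ C := by
      refine hC.le_of_ge (y := insert f C) ?_ (Finset.subset_insert _ _)
        (Finset.mem_insert_self _ _)
      intro x hx y hy hxy
      rcases Finset.mem_insert.1 hx with hxf | hx <;> rcases Finset.mem_insert.1 hy with hyf | hy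
      · exact absurd (hxf.trans hyf.symm) hxy
      · exact hxf ▸ hf y hy
      · rw [agreement_comm]; exact hyf ▸ hf x hx
      · exact hC.prop x hx y hy hxy
    have := hf f hmem
    simp only [agreement, Finset.filter_true, Finset.card_univ, Fintype.card_fin] at this
    omega
  have hcard := (Finset.card_le_card hcover).trans Finset.card_biUnion_le
  rw [Finset.card_univ, Fintype.card_pi_const, Fintype.card_fin] at hcard
  calc (b : ℝ) ^ k
      ≤ ∑ g ∈ C, ((Finset.univ.filter fun f => k ≤ 2 * agreement f g).card : ℝ) := by
        exact_mod_cast hcard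
    _ ≤ ∑ g ∈ C, (2 * √((b : ℝ) - 1)) ^ k :=
        Finset.sum_le_sum fun g _ => card_agreement_ball_le hb g
    _ = _ := by rw [Finset.sum_const, nsmul_eq_mul]

/-- The indicator vector of the graph of a word. -/
def codeVector {n : ℕ} (e : Fin k × Fin b → Fin n) (f : Fin k → Fin b) : Fin n → ℝ :=
  Function.extend e (fun p => if f p.1 = p.2 then 1 else 0) 0

lemma l0_codeVector_le {n : ℕ} {e : Fin k × Fin b → Fin n} (he : Function.Injective e)
    (f : Fin k → Fin b) : l0 (codeVector e f) ≤ k := by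
  have hsub : (Finset.univ.filter fun i => codeVector e f i ≠ 0) ⊆
      Finset.univ.image fun j => e (j, f j) := by
    intro i hi
    have hi := (Finset.mem_filter.1 hi).2
    by_cases h : ∃ p, e p = i
    · obtain ⟨p, rfl⟩ := h
      rw [codeVector, he.extend_apply] at hi
      have hp : f p.1 = p.2 := by by_contra h; simp [h] at hi
      exact Finset.mem_image.2 ⟨p.1, Finset.mem_univ _, by rw [hp]⟩
    · exact absurd (Function.extend_apply' _ _ _ h) hi
  exact (Finset.card_le_card hsub).trans (Finset.card_image_le.trans (by simp))

lemma lqq_codeVector {n : ℕ} {q : ℝ} (hq : q ≠ 0) {e : Fin k × Fin b → Fin n}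
    (he : Function.Injective e) (f : Fin k → Fin b) : lqq q (codeVector e f) = k := by
  rw [lqq, ← Fintype.sum_of_injective e he (fun p => if f p.1 = p.2 then 1 else 0)]
  · rw [Fintype.sum_prod_type]
    simp
  · intro i hi
    rw [codeVector, Function.extend_apply' _ _ _ (by simpa using hi)]
    simp [Real.zero_rpow hq]
  · intro p
    rw [codeVector, he.extend_apply]
    split_ifs <;> simp [Real.zero_rpow hq]

lemma lqq_codeVector_sub {n : ℕ} {q : ℝ} (hq : q ≠ 0) {e : Fin k × Fin b → Fin n}
    (he : Function.Injective e) (f g : Fin k → Fin b) :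
    lqq q (codeVector e f - codeVector e g) = 2 * (k - agreement f g) := by
  rw [lqq, ← Fintype.sum_of_injective e he
    (fun p => |(if f p.1 = p.2 then (1 : ℝ) else 0) - if g p.1 = p.2 then 1 else 0| ^ q)]
  · have hrow : ∀ j, ∑ x : Fin b,
        |(if f j = x then (1 : ℝ) else 0) - if g j = x then 1 else 0| ^ q
          = 2 - 2 * if f j = g j then 1 else 0 := by
      intro j
      have hx : ∀ x : Fin b, |(if f j = x then (1 : ℝ) else 0) - if g j = x then 1 else 0| ^ q
          = (if f j = x then 1 else 0) + (if g j = x then 1 else 0)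
            - 2 * if f j = x then (if f j = g j then 1 else 0) else 0 := by
        intro x
        by_cases h1 : f j = x <;> by_cases h2 : g j = x
        · simp [h1, h2, Real.zero_rpow hq]; norm_num
        · have : f j ≠ g j := fun h => h2 (h ▸ h1)
          simp only [if_pos h1, if_neg h2, if_neg this]
          simp
        · simp [h1, h2]
        · simp [h1, h2, Real.zero_rpow hq]
      simp only [hx, Finset.sum_sub_distrib, Finset.sum_add_distrib, ← Finset.mul_sum,
        Finset.sum_ite_eq, Finset.mem_univ, if_true]
      ring
    rw [Fintype.sum_prod_type]
    simp only [hrow, Finset.sum_sub_distrib, ← Finset.mul_sum, Finset.sum_boole, agreement]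
    simp
    ring
  · intro i hi
    have hi' : ¬ ∃ p, e p = i := by simpa using hi
    simp [codeVector, Function.extend_apply' _ _ _ hi', Real.zero_rpow hq]
  · intro p
    simp [codeVector, he.extend_apply]

end coding

open MeasureTheory Module Pointwise in
/-- Volumetric packing bound. -/
lemma card_le_of_disjoint_translates {E ι : Type*} [NormedAddCommGroup E] [NormedSpace ℝ E]
    [FiniteDimensional ℝ E] [MeasurableSpace E] [BorelSpace E] {K : Set E} (hK : IsCompact K)
    (hK' : (interior K).Nonempty) {C : Finset ι} {p : ι → E} {r : ℝ} (hr : 0 ≤ r)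
    (hdisj : ∀ i ∈ C, ∀ j ∈ C, i ≠ j → Disjoint (p i +ᵥ K) (p j +ᵥ K))
    (hsub : ∀ i ∈ C, p i +ᵥ K ⊆ r • K) : (C.card : ℝ) ≤ r ^ finrank ℝ E := by
  let μ : Measure E := Measure.addHaar
  have h0 : μ K ≠ 0 := ((Measure.measure_pos_of_nonempty_interior μ hK')).ne'
  have htop : μ K ≠ ⊤ := hK.measure_lt_top.ne
  have hmeas : ∀ i ∈ C, MeasurableSet (p i +ᵥ K) := fun i _ => (hK.vadd (p i)).measurableSet
  have h : (C.card : ENNReal) * μ K ≤ ENNReal.ofReal (r ^ finrank ℝ E) * μ K := by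
    calc (C.card : ENNReal) * μ K = ∑ i ∈ C, μ (p i +ᵥ K) := by
          simp [measure_vadd, Finset.sum_const, nsmul_eq_mul]
      _ = μ (⋃ i ∈ C, p i +ᵥ K) :=
          (measure_biUnion_finset (fun i hi j hj hij => hdisj i hi j hj hij) hmeas).symm
      _ ≤ μ (r • K) := measure_mono (Set.iUnion₂_subset hsub)
      _ = _ := by rw [Measure.addHaar_smul, abs_of_nonneg (by positivity)]
  have h := (ENNReal.mul_le_mul_iff_left h0 htop).1 h
  rwa [← ENNReal.ofReal_natCast, ENNReal.ofReal_le_ofReal_iff (by positivity)] at h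

open Module in
lemma finrank_quotient_map_ker_le {m n d : ℕ} (X : Matrix (Fin m) (Fin d) ℝ)
    (D : Matrix (Fin n) (Fin d) ℝ) (hD : Function.Surjective D.mulVecLin) :
    finrank ℝ ((Fin n → ℝ) ⧸ (LinearMap.ker X.mulVecLin).map D.mulVecLin) ≤ m := by
  set V := (LinearMap.ker X.mulVecLin).map D.mulVecLin
  have hle : LinearMap.ker X.mulVecLin ≤ V.comap D.mulVecLin := Submodule.le_comap_map _ _
  have hsurj : Function.Surjective (Submodule.mapQ _ V D.mulVecLin hle) := by
    intro y
    obtain ⟨u, rfl⟩ := Submodule.mkQ_surjective _ y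
    obtain ⟨x, rfl⟩ := hD u
    exact ⟨Submodule.Quotient.mk x, rfl⟩
  calc _ ≤ finrank ℝ ((Fin d → ℝ) ⧸ LinearMap.ker X.mulVecLin) :=
        LinearMap.finrank_le_finrank_of_surjective hsurj
    _ = finrank ℝ (LinearMap.range X.mulVecLin) := X.mulVecLin.quotKerEquivRange.finrank_eq
    _ ≤ finrank ℝ (Fin m → ℝ) := Submodule.finrank_le _
    _ = m := by simp

open Pointwise in
/-- Volumetric bound for well separated sparse vectors, when minimization of the
`ℓq` quasi-norm over the cosets of `V` is instance optimal. -/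
lemma card_le_of_instance_optimal {n k : ℕ} {ι : Type*} {q A R : ℝ} (hq0 : 0 < q) (hq1 : q ≤ 1)
    (hA : 0 ≤ A) (hR : 0 < R) (V : Submodule ℝ (Fin n → ℝ))
    (hopt : ∀ u w, w - u ∈ V → (∀ z, z - u ∈ V → lqq q w ≤ lqq q z) →
      lqq q (w - u) ≤ A * sigmaK k q u ^ q)
    {C : Finset ι} {u : ι → Fin n → ℝ} (hsparse : ∀ i ∈ C, l0 (u i) ≤ k)
    (hnorm : ∀ i ∈ C, lqq q (u i) ≤ R)
    (hsep : ∀ i ∈ C, ∀ j ∈ C, i ≠ j → R < lqq q (u i - u j)) :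
    (C.card : ℝ) ≤ ((2 * A + 3) ^ q⁻¹) ^ Module.finrank ℝ ((Fin n → ℝ) ⧸ V) := by
  set r := Module.finrank ℝ ((Fin n → ℝ) ⧸ V)
  let L : ((Fin n → ℝ) ⧸ V) ≃ₗ[ℝ] (Fin r → ℝ) := LinearEquiv.ofFinrankEq _ _ (by simp [r])
  let T : (Fin n → ℝ) →ₗ[ℝ] (Fin r → ℝ) := L.toLinearMap ∘ₗ V.mkQ
  have hT : ∀ x y, T x = T y → x - y ∈ V := by
    intro x y hxy
    exact (Submodule.Quotient.eq V).1 (L.injective hxy)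
  have hTsurj : Function.Surjective T := L.surjective.comp (Submodule.mkQ_surjective V)
  set s := R / (2 * A + 2) with hs
  have hs0 : 0 < s := by positivity
  have hsR : (2 * A + 2) * s = R := by rw [hs]; field_simp
  let B : Set (Fin n → ℝ) := {v | lqq q v ≤ s}
  have hB : IsCompact B := isCompact_lqq_le hq0 s
  have hK : IsCompact (T '' B) := hB.image T.continuous_of_finiteDimensional
  have hK' : (interior (T '' B)).Nonempty := by
    have hopen : IsOpen (T '' {v | lqq q v < s}) :=
      T.isOpenMap_of_finiteDimensional hTsurj _
        (isOpen_lt (continuous_lqq hq0.le) continuous_const)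
    have hsub : T '' {v | lqq q v < s} ⊆ T '' B :=
      Set.image_mono fun v (hv : lqq q v < s) => hv.le
    exact ⟨T 0, interior_maximal hsub hopen ⟨0, by simpa [lqq_zero hq0.ne'] using hs0, rfl⟩⟩
  have happrox : ∀ i ∈ C, ∀ v ∈ B, ∀ w, w - (u i + v) ∈ V →
      (∀ z, z - (u i + v) ∈ V → lqq q w ≤ lqq q z) → lqq q (u i - w) ≤ (A + 1) * s := by
    intro i hi v hv w hw hmin
    have h1 := hopt _ w hw hmin
    have h2 := sigmaK_rpow_le hq0 (hsparse i hi) (u i + v)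
    rw [add_sub_cancel_left] at h2
    have h3 := lqq_add_le hq0.le hq1 (w - (u i + v)) v
    rw [show w - (u i + v) + v = w - u i by abel, lqq_sub_comm] at h3
    have hv : lqq q v ≤ s := hv
    nlinarith [mul_le_mul_of_nonneg_left (h2.trans hv) hA]
  have key := card_le_of_disjoint_translates hK hK' (C := C) (p := fun i => T (u i))
    (r := (2 * A + 3) ^ q⁻¹) (by positivity) ?_ ?_
  · simpa using key
  · intro i hi j hj hij
    rw [Set.disjoint_left]
    rintro _ ⟨_, ⟨v, hv, rfl⟩, rfl⟩ ⟨_, ⟨v', hv', rfl⟩, hEq⟩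
    have hEq : T (u j + v') = T (u i + v) := by simpa using hEq
    have hV := hT _ _ hEq
    obtain ⟨w, hw, hmin⟩ := exists_lqq_minimizer hq0 V (u i + v)
    have h1 := happrox i hi v hv w hw hmin
    have h2 := happrox j hj v' hv' w (by simpa using V.sub_mem hw hV)
      fun z hz => hmin z (by simpa using V.add_mem hz hV)
    have h3 := lqq_add_le hq0.le hq1 (u i - w) (w - u j)
    rw [sub_add_sub_cancel, lqq_sub_comm q w] at h3
    have h4 := hsep i hi j hj hij
    linarith
  · rintro i hi _ ⟨_, ⟨v, hv, rfl⟩, rfl⟩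
    set c := (2 * A + 3) ^ q⁻¹ with hc
    have hc0 : 0 < c := by positivity
    refine Set.mem_smul_set.2 ⟨T (c⁻¹ • (u i + v)), ⟨_, ?_, rfl⟩, ?_⟩
    · change lqq q _ ≤ s
      rw [lqq_smul (by positivity), Real.inv_rpow hc0.le, hc,
        Real.rpow_inv_rpow (by positivity) hq0.ne', inv_mul_le_iff₀ (by positivity)]
      have h1 := lqq_add_le hq0.le hq1 (u i) v
      have h2 := hnorm i hi
      have hv : lqq q v ≤ s := hv
      linarith
    · rw [← map_smul, smul_inv_smul₀ hc0.ne']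
      simp

lemma sqrt_div_four_mul_le {n k b : ℕ} (hk : 0 < k) (hb : 2 ≤ b) (hn : n < k * (b + 1)) :
    √((n : ℝ) / (4 * k)) ≤ b / (2 * √((b : ℝ) - 1)) := by
  have hb' : (2 : ℝ) ≤ b := by exact_mod_cast hb
  have hk' : (0 : ℝ) < k := by exact_mod_cast hk
  have hn' : (n : ℝ) ≤ k * (b + 1) := by exact_mod_cast hn.le
  have hb1 : (0 : ℝ) < b - 1 := by linarith
  refine Real.sqrt_le_iff.2 ⟨by positivity, ?_⟩
  rw [div_pow, mul_pow, Real.sq_sqrt hb1.le, div_le_div_iff₀ (by positivity) (by positivity)]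
  nlinarith [mul_le_mul_of_nonneg_right hn' hb1.le]

/-- if every minimizer of the noiseless ℓq-analysis minimization problem with
data `y = Xβ` satisfies the ℓq instance-optimality bound
`‖Dβ̂ − Dβ‖_q^q ≤ 2(2c₂^q + 1) σ_k(Dβ)_q^q`, then `m ≥ C₂ q k log(n/4k)` with
`C₂ = 1/(2 log(8c₂^q + 7))`. -/
theorem sample_complexity_lower_bound_lq_analysis
    {m n d k : ℕ} (q c₂ : ℝ) (hq0 : 0 < q) (hq1 : q ≤ 1) (hc₂ : 0 < c₂)
    (hkn : 4 * k < n)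
    (X : Matrix (Fin m) (Fin d) ℝ) (D : Matrix (Fin n) (Fin d) ℝ)
    (hD : ∀ u : Fin n → ℝ, ∃ β : Fin d → ℝ, D.mulVec β = u)
    (hrec : ∀ β bhat : Fin d → ℝ, Minimizer q X D (X.mulVec β) bhat →
      lqq q (D.mulVec bhat - D.mulVec β)
        ≤ 2 * (2 * c₂ ^ q + 1) * (sigmaK k q (D.mulVec β)) ^ q) :
    (m : ℝ) ≥ (1 / (2 * Real.log (8 * c₂ ^ q + 7))) * q * k * Real.log ((n : ℝ) / (4 * k)) := by
  have hc : 0 < c₂ ^ q := Real.rpow_pos_of_pos hc₂ q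
  rcases Nat.eq_zero_or_pos k with rfl | hk
  · simp
  set b := n / k with hb_def
  have hb4 : 4 ≤ b := (Nat.le_div_iff_mul_le hk).2 hkn.le
  have hb2 : 2 ≤ b := by omega
  have hcard : Fintype.card (Fin k × Fin b) ≤ Fintype.card (Fin n) := by
    simpa using Nat.mul_div_le n k
  obtain ⟨e⟩ := Function.Embedding.nonempty_of_card_le hcard
  obtain ⟨C, hCsep, hCcard⟩ := exists_code (k := k) hb2
  set V := (LinearMap.ker X.mulVecLin).map D.mulVecLin with hV
  have hopt : ∀ u w, w - u ∈ V → (∀ z, z - u ∈ V → lqq q w ≤ lqq q z) →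
      lqq q (w - u) ≤ 2 * (2 * c₂ ^ q + 1) * sigmaK k q u ^ q := by
    intro u w ⟨h, hh, hhw⟩ hmin
    obtain ⟨β, rfl⟩ := hD u
    have hXh : X.mulVec h = 0 := hh
    have hDh : D.mulVec (β + h) = w := by
      rw [Matrix.mulVec_add, show D.mulVec h = w - D.mulVec β from hhw, add_sub_cancel]
    have := hrec β (β + h) ⟨by rw [Matrix.mulVec_add, hXh, add_zero], fun z hz => ?_⟩
    · rwa [hDh] at this
    · rw [hDh]
      refine hmin _ ⟨z - β, ?_, ?_⟩
      · change X.mulVec (z - β) = 0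
        rw [Matrix.mulVec_sub, hz, sub_self]
      · exact Matrix.mulVec_sub D z β
  have hk' : (0 : ℝ) < k := by exact_mod_cast hk
  have hpack := card_le_of_instance_optimal hq0 hq1 (by positivity) hk' V hopt (C := C)
    (u := codeVector e) (fun f _ => l0_codeVector_le e.injective f)
    (fun f _ => (lqq_codeVector hq0.ne' e.injective f).le) fun f hf g hg hfg => by
      rw [lqq_codeVector_sub hq0.ne' e.injective]
      have : (2 * agreement f g : ℝ) < k := by exact_mod_cast hCsep f hf g hg hfg
      linarith
  rw [show 2 * (2 * (2 * c₂ ^ q + 1)) + 3 = 8 * c₂ ^ q + 7 by ring] at hpack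
  have hA1 : 1 < 8 * c₂ ^ q + 7 := by linarith
  have hpow : √((n : ℝ) / (4 * k)) ^ k ≤ ((8 * c₂ ^ q + 7) ^ q⁻¹) ^ m := by
    have hb2' : (2 : ℝ) ≤ b := by exact_mod_cast hb2
    have hs : 0 < √((b : ℝ) - 1) := Real.sqrt_pos.2 (by linarith)
    calc √((n : ℝ) / (4 * k)) ^ k ≤ (b / (2 * √((b : ℝ) - 1))) ^ k :=
          pow_le_pow_left₀ (Real.sqrt_nonneg _)
            (sqrt_div_four_mul_le hk hb2 (Nat.lt_mul_div_succ n hk)) k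
      _ ≤ C.card := by
          rw [div_pow, div_le_iff₀ (by positivity)]
          exact hCcard
      _ ≤ _ := hpack
      _ ≤ _ := pow_le_pow_right₀ (Real.one_le_rpow hA1.le (by positivity))
          (finrank_quotient_map_ker_le X D hD)
  have hn' : (0 : ℝ) < n := by exact_mod_cast (by omega : 0 < n)
  have hlog := Real.log_le_log (by positivity) hpow
  rw [Real.log_pow, Real.log_pow, Real.log_sqrt (by positivity),
    Real.log_rpow (by linarith)] at hlog
  have hL : 0 < Real.log (8 * c₂ ^ q + 7) := Real.log_pos hA1
  rw [ge_iff_le, one_div, mul_assoc, mul_assoc, inv_mul_le_iff₀ (by positivity)]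
  calc q * (k * Real.log (n / (4 * k))) = 2 * q * (k * (Real.log (n / (4 * k)) / 2)) := by ring
    _ ≤ 2 * q * (m * (q⁻¹ * Real.log (8 * c₂ ^ q + 7))) := by gcongr
    _ = _ := by field_simp
end
end

section
/- Fix κ ≥ 1, 0 < q ≤ 1, and define f(ρ,κ) = (ρ(1−κ⁴) + κ²√(4ρ+1)) / (ρ(κ²+1)² + κ²). Suppose there exist S₁ ∈ ℕ and t with t·S₁ ∈ ℕ, t > 0, such that the D-RIP constant of X satisfies δ_{(t+1)S₁} < f(ρ,κ) with ρ = t^{−1}/4. Then, setting S_q = ⌊(t+1)/(t^{q/(2−q)}+1) · S₁⌋, there exists l > 0 with l^q·S_q ∈ ℕ such that (t+1)S₁ = (l^q+1)S_q and δ_{(l^q+1)S_q} < f(ρ',κ) with ρ' = l^{q−2}/4. In particular, the exact-recovery sufficient condition for ℓq-analysis minimization holds at sparsity level S_q ≥ S₁, so the ℓq-analysis minimization with q < 1 can recover vectors β with ‖Dβ‖_0 = S_q = ⌊(t+1)/(t^{q/(2−q)}+1)·S₁⌋, a wider range of cosparsity than ℓ₁-analysis minimization. -/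
open scoped BigOperators

noncomputable section

/-- Euclidean norm. -/
def l2 {n : ℕ} (v : Fin n → ℝ) : ℝ := Real.sqrt (∑ i, (v i) ^ 2)

/-- `β` is the unique minimizer of the noiseless ℓq-analysis minimization problem
`min ‖Dz‖_q^q  s.t. Xz = y`. -/
def UniqueMinimizer {m n d : ℕ} (q : ℝ) (X : Matrix (Fin m) (Fin d) ℝ)
    (D : Matrix (Fin n) (Fin d) ℝ) (y : Fin m → ℝ) (β : Fin d → ℝ) : Prop :=
  X.mulVec β = y ∧
    ∀ z : Fin d → ℝ, X.mulVec z = y → z ≠ β →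
      lqq q (D.mulVec β) < lqq q (D.mulVec z)

/-- The D-RIP constant `δ_s` of `X` relative to `D`: the smallest `δ ≥ 0` such that
`(1-δ)‖w‖₂² ≤ ‖Xw‖₂² ≤ (1+δ)‖w‖₂²` for all `w = Dᵀu` with `‖u‖₀ ≤ s`. -/
def dripConst {m n d : ℕ} (X : Matrix (Fin m) (Fin d) ℝ)
    (D : Matrix (Fin n) (Fin d) ℝ) (s : ℕ) : ℝ :=
  sInf {δ : ℝ | 0 ≤ δ ∧ ∀ u : Fin n → ℝ, l0 u ≤ s →
    (1 - δ) * (l2 (D.transpose.mulVec u)) ^ 2 ≤ (l2 (X.mulVec (D.transpose.mulVec u))) ^ 2 ∧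
    (l2 (X.mulVec (D.transpose.mulVec u))) ^ 2 ≤ (1 + δ) * (l2 (D.transpose.mulVec u)) ^ 2}

/-- Maximal singular value of `D` (as the supremum of `‖Dv‖₂/‖v‖₂`). -/
def sigmaMax {n d : ℕ} (D : Matrix (Fin n) (Fin d) ℝ) : ℝ :=
  sSup {r : ℝ | ∃ v : Fin d → ℝ, v ≠ 0 ∧ r = l2 (D.mulVec v) / l2 v}

/-- Minimal (nonzero, for full column rank `D`) singular value of `D`
(as the infimum of `‖Dv‖₂/‖v‖₂`). -/
def sigmaMin {n d : ℕ} (D : Matrix (Fin n) (Fin d) ℝ) : ℝ :=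
  sInf {r : ℝ | ∃ v : Fin d → ℝ, v ≠ 0 ∧ r = l2 (D.mulVec v) / l2 v}

/-- The right hand side bound `f(ρ,κ)` of the recovery sufficient condition. -/
def ripBound (ρ κ : ℝ) : ℝ :=
  (ρ * (1 - κ ^ 4) + κ ^ 2 * Real.sqrt (4 * ρ + 1)) / (ρ * (κ ^ 2 + 1) ^ 2 + κ ^ 2)

/-- Closed form of `ripBound` as a Möbius function of `Real.sqrt (4ρ+1)`. -/
theorem ripBound_eq_div {ρ κ : ℝ} (hκ : 1 ≤ κ) (hρ : 0 < ρ) :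
    ripBound ρ κ = ((κ ^ 2 + 1) - (κ ^ 2 - 1) * Real.sqrt (4 * ρ + 1)) /
      ((κ ^ 2 + 1) * Real.sqrt (4 * ρ + 1) - (κ ^ 2 - 1)) := by
  have hs : 1 ≤ Real.sqrt (4 * ρ + 1) := Real.one_le_sqrt.2 (by linarith)
  have hsq : Real.sqrt (4 * ρ + 1) ^ 2 = 4 * ρ + 1 := Real.sq_sqrt (by linarith)
  have hk : 1 ≤ κ ^ 2 := one_le_pow₀ hκ
  unfold ripBound
  generalize Real.sqrt (4 * ρ + 1) = s at hs hsq ⊢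
  obtain rfl : ρ = (s ^ 2 - 1) / 4 := by linarith
  have hden : (κ ^ 2 + 1) * s - (κ ^ 2 - 1) ≠ 0 := by nlinarith
  have hden' : (s ^ 2 - 1) / 4 * (κ ^ 2 + 1) ^ 2 + κ ^ 2 ≠ 0 := by positivity
  rw [div_eq_div_iff hden' hden]
  ring

/-- `ripBound` is antitone in its first argument on the positive reals. -/
theorem ripBound_le_ripBound {ρ ρ' κ : ℝ} (hκ : 1 ≤ κ) (hρ' : 0 < ρ') (h : ρ' ≤ ρ) :
    ripBound ρ κ ≤ ripBound ρ' κ := by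
  have hk : 1 ≤ κ ^ 2 := one_le_pow₀ hκ
  rw [ripBound_eq_div hκ hρ', ripBound_eq_div hκ (hρ'.trans_le h)]
  have hs' : 1 ≤ Real.sqrt (4 * ρ' + 1) := Real.one_le_sqrt.2 (by linarith)
  have hs : Real.sqrt (4 * ρ' + 1) ≤ Real.sqrt (4 * ρ + 1) := Real.sqrt_le_sqrt (by linarith)
  generalize Real.sqrt (4 * ρ' + 1) = s' at hs hs' ⊢
  generalize Real.sqrt (4 * ρ + 1) = s at hs ⊢
  rw [div_le_div_iff₀ (by nlinarith) (by nlinarith)]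
  nlinarith [mul_nonneg (sub_nonneg.2 hs) (zero_le_one.trans hk)]

/-- The sparsity level `⌊(t+1)/(t^{q/(2-q)}+1)·S⌋` is at least one. -/
theorem one_le_sparsity {q t : ℝ} {S T : ℕ} (hq0 : 0 < q) (hq1 : q ≤ 1) (ht : 0 < t)
    (hS : 0 < S) (hT : (T : ℝ) = t * S) :
    1 ≤ (t + 1) / (t ^ (q / (2 - q)) + 1) * S := by
  have ha : 0 < t ^ (q / (2 - q)) := Real.rpow_pos_of_pos ht _
  have he0 : 0 ≤ q / (2 - q) := div_nonneg hq0.le (by linarith)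
  have he1 : q / (2 - q) ≤ 1 := (div_le_one (by linarith)).2 (by linarith)
  have hS' : (1 : ℝ) ≤ S := by exact_mod_cast hS
  rw [div_mul_eq_mul_div, one_le_div (by positivity)]
  rcases le_total 1 t with h | h
  · have hle : t ^ (q / (2 - q)) ≤ t := by
      simpa using Real.rpow_le_rpow_of_exponent_le h he1
    nlinarith
  · have hle : t ^ (q / (2 - q)) ≤ 1 := Real.rpow_le_one ht.le h he0
    have hT0 : 0 < T := by
      have : (0 : ℝ) < T := by rw [hT]; positivity
      exact_mod_cast this
    have hT1 : (1 : ℝ) ≤ T := by exact_mod_cast hT0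
    linarith

/-- if the exact-recovery sufficient condition
`δ_{(t+1)S₁} < f(t⁻¹/4, κ)` for ℓ₁-analysis minimization holds, then with
`S_q = ⌊(t+1)/(t^{q/(2−q)}+1)·S₁⌋` there exists `l > 0` with `l^q S_q ∈ ℕ`,
`(t+1)S₁ = (l^q+1)S_q`, and `δ_{(l^q+1)S_q} < f(l^{q−2}/4, κ)`; i.e. the sufficient
condition for ℓq-analysis minimization holds at the sparsity level `S_q`. -/
theorem lq_analysis_wider_cosparsity
    {m n d : ℕ} (X : Matrix (Fin m) (Fin d) ℝ) (D : Matrix (Fin n) (Fin d) ℝ)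
    (κ q t : ℝ) (S₁ tS₁ : ℕ)
    (hκ : 1 ≤ κ) (hq0 : 0 < q) (hq1 : q ≤ 1) (ht : 0 < t) (hS₁ : 0 < S₁)
    (htS : (tS₁ : ℝ) = t * S₁)
    (hδ : dripConst X D (tS₁ + S₁) < ripBound (t⁻¹ / 4) κ) :
    ∃ l : ℝ, 0 < l ∧
      (∃ lqSq : ℕ,
        (lqSq : ℝ) = l ^ q * (Nat.floor ((t + 1) / (t ^ (q / (2 - q)) + 1) * S₁) : ℕ)) ∧
      (t + 1) * (S₁ : ℝ)
        = (l ^ q + 1) * (Nat.floor ((t + 1) / (t ^ (q / (2 - q)) + 1) * S₁) : ℕ) ∧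
      dripConst X D (tS₁ + S₁) < ripBound (l ^ (q - 2) / 4) κ := by
  have ha : 0 < t ^ (q / (2 - q)) := Real.rpow_pos_of_pos ht _
  have hone := one_le_sparsity hq0 hq1 ht hS₁ htS
  have hfloor := Nat.floor_le (zero_le_one.trans hone)
  have hpos := Nat.floor_pos.2 hone
  generalize ⌊(t + 1) / (t ^ (q / (2 - q)) + 1) * S₁⌋₊ = s at hfloor hpos ⊢
  have hs : (0 : ℝ) < s := by exact_mod_cast hpos
  have hbound : (t ^ (q / (2 - q)) + 1) * s ≤ (t + 1) * S₁ := by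
    rwa [div_mul_eq_mul_div, le_div_iff₀ (by positivity), mul_comm] at hfloor
  set b : ℝ := (t + 1) * S₁ / s - 1 with hb
  have hab : t ^ (q / (2 - q)) ≤ b := by
    rw [hb, le_sub_iff_add_le, le_div_iff₀ hs]
    exact hbound
  have hb0 : 0 < b := ha.trans_le hab
  have hbs : (b + 1) * s = (t + 1) * S₁ := by
    rw [hb, sub_add_cancel, div_mul_cancel₀ _ hs.ne']
  have hlq : (b ^ q⁻¹) ^ q = b := Real.rpow_inv_rpow hb0.le hq0.ne'
  have hle : s ≤ tS₁ + S₁ := by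
    have : (s : ℝ) ≤ (tS₁ + S₁ : ℕ) := by
      push_cast
      nlinarith [mul_pos hb0 hs]
    exact_mod_cast this
  refine ⟨b ^ q⁻¹, Real.rpow_pos_of_pos hb0 _, ⟨tS₁ + S₁ - s, ?_⟩, ?_, ?_⟩
  · rw [hlq, Nat.cast_sub hle]
    push_cast
    linarith
  · rw [hlq, hbs]
  · refine hδ.trans_le (ripBound_le_ripBound hκ (by positivity) ?_)
    have hexp : (b ^ q⁻¹) ^ (q - 2) ≤ t⁻¹ := by
      rw [← Real.rpow_mul hb0.le]
      calc b ^ (q⁻¹ * (q - 2)) ≤ (t ^ (q / (2 - q))) ^ (q⁻¹ * (q - 2)) :=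
            Real.rpow_le_rpow_of_nonpos ha hab
              (mul_nonpos_of_nonneg_of_nonpos (by positivity) (by linarith))
        _ = t⁻¹ := by
            rw [← Real.rpow_mul ht.le, ← Real.rpow_neg_one t]
            congr 1
            have : 2 - q ≠ 0 := by linarith
            field_simp
            ring
    linarith
end
end
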